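/- arXiv:1905.00775 — 2 statements merged into one kernel-verified Lean document; each statement's English description precedes it below -/
import Mathlib

section
/- Let E be a real Hilbert space, D ⊆ E a nonempty closed convex set, and ψ : E → ℝ a differentiable function whose gradient ∇ψ is Lipschitz with constant Θ > 0. Let 0 < α ≤ 1/Θ. For x ∈ D and c > 0, define 𝒟(x,c) := −2c · inf_{y ∈ D} { ⟨∇ψ(x), y − x⟩ + (c/2)‖y − x‖² }. Assume ψ attains its infimum ψ* over D, and assume the Polyak–Łojasiewicz-type inequality (1/2)·𝒟(x, 1/α) ≥ κ·(ψ(x) − ψ*) holds for all x ∈ D, for some κ > 0. Then for any x ∈ D, if x⁺ ∈ D is a minimizer over D of y ↦ ⟨∇ψ(x), y − x⟩ + (1/(2α))‖y − x‖², it holds that ψ(x⁺) − ψ* ≤ (1 − α κ)·(ψ(x) − ψ*). -/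
open scoped RealInnerProductSpace

/-- The quantity `𝒟(x, c) = -2c · inf_{y ∈ D} { ⟨∇ψ(x), y - x⟩ + (c/2)‖y - x‖² }`,
where `g x = ∇ψ(x)`. -/
noncomputable def Dcal {E : Type*} [NormedAddCommGroup E] [InnerProductSpace ℝ E]
    (g : E → E) (D : Set E) (x : E) (c : ℝ) : ℝ :=
  -2 * c * sInf ((fun y => ⟪g x, y - x⟫ + c / 2 * ‖y - x‖ ^ 2) '' D)

/-- The descent lemma: a function whose gradient is Lipschitz with constant `K` is bounded above by
its linearization plus `K / 2` times the squared distance. -/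
theorem le_add_inner_add_sq_of_lipschitzWith_gradient {E : Type*} [NormedAddCommGroup E]
    [InnerProductSpace ℝ E] [CompleteSpace E] {f : E → ℝ} {f' : E → E} {K : NNReal}
    (hf : ∀ x, HasGradientAt f (f' x) x) (hf' : LipschitzWith K f') (x y : E) :
    f y ≤ f x + ⟪f' x, y - x⟫ + K / 2 * ‖y - x‖ ^ 2 := by
  set v := y - x with hv
  let φ : ℝ → ℝ := fun t => f (x + t • v) - t * ⟪f' x, v⟫ - K / 2 * ‖v‖ ^ 2 * t ^ 2
  have hφ (t : ℝ) :
      HasDerivAt φ (⟪f' (x + t • v), v⟫ - ⟪f' x, v⟫ - K * ‖v‖ ^ 2 * t) t := by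
    have hline : HasDerivAt (fun s : ℝ => x + s • v) v t := by
      simpa using ((hasDerivAt_id t).smul_const v).const_add x
    have hcomp := (hf (x + t • v)).hasFDerivAt.comp_hasDerivAt t hline
    have hlin := (hasDerivAt_id t).mul_const ⟪f' x, v⟫
    have hquad := (hasDerivAt_pow 2 t).const_mul (K / 2 * ‖v‖ ^ 2 : ℝ)
    refine ((hcomp.sub hlin).sub hquad).congr_deriv ?_
    simp only [InnerProductSpace.toDual_apply_apply]
    push_cast
    ring
  have hanti : AntitoneOn φ (Set.Icc 0 1) := by
    refine antitoneOn_of_deriv_nonpos (convex_Icc 0 1)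
      (fun t _ => (hφ t).continuousAt.continuousWithinAt)
      (fun t _ => (hφ t).differentiableAt.differentiableWithinAt) fun t ht => ?_
    have ht0 : 0 ≤ t := (interior_subset ht).1
    rw [(hφ t).deriv, ← inner_sub_left]
    have hnorm : ‖f' (x + t • v) - f' x‖ ≤ K * (t * ‖v‖) := by
      simpa [norm_smul, abs_of_nonneg ht0] using hf'.norm_sub_le (x + t • v) x
    have hinner := real_inner_le_norm (f' (x + t • v) - f' x) v
    nlinarith [mul_le_mul_of_nonneg_right hnorm (norm_nonneg v)]
  have h := hanti (Set.left_mem_Icc.2 zero_le_one) (Set.right_mem_Icc.2 zero_le_one) zero_le_one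
  simp only [φ, hv, one_smul, zero_smul, add_zero, add_sub_cancel] at h
  linarith

/-- Eq. (eq:pl) of the paper: under a Lipschitz gradient and the PL-type inequality
`(1/2)𝒟(x, 1/α) ≥ κ (ψ(x) - ψ*)` on the closed convex set `D`, one projected-gradient
step (minimizer of the linearized proximal model over `D`) contracts the optimality
gap by the factor `1 - ακ`. -/
theorem projected_gradient_linear_rate {E : Type*} [NormedAddCommGroup E]
    [InnerProductSpace ℝ E] [CompleteSpace E]
    (D : Set E) (hD : D.Nonempty) (hDclosed : IsClosed D) (hDconv : Convex ℝ D)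
    (ψ : E → ℝ) (g : E → E) (hg : ∀ x, HasGradientAt ψ (g x) x)
    (Θ : ℝ) (hΘ : 0 < Θ) (hLip : LipschitzWith Θ.toNNReal g)
    (α : ℝ) (hα0 : 0 < α) (hα : α ≤ 1 / Θ)
    (ψstar : ℝ) (hψstar : ∃ x ∈ D, ψ x = ψstar ∧ ∀ y ∈ D, ψstar ≤ ψ y)
    (κ : ℝ) (hκ : 0 < κ)
    (hPL : ∀ x ∈ D, κ * (ψ x - ψstar) ≤ (1 / 2) * Dcal g D x (1 / α)) :
    ∀ x ∈ D, ∀ xp ∈ D,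
      (∀ y ∈ D, ⟪g x, xp - x⟫ + 1 / (2 * α) * ‖xp - x‖ ^ 2 ≤
        ⟪g x, y - x⟫ + 1 / (2 * α) * ‖y - x‖ ^ 2) →
      ψ xp - ψstar ≤ (1 - α * κ) * (ψ x - ψstar) := by
  intro x hx xp hxp hmin
  have hdesc := le_add_inner_add_sq_of_lipschitzWith_gradient hg hLip x xp
  rw [Real.coe_toNNReal Θ hΘ.le] at hdesc
  have hstep : Θ / 2 * ‖xp - x‖ ^ 2 ≤ 1 / (2 * α) * ‖xp - x‖ ^ 2 := by
    have hΘα : Θ ≤ 1 / α := (le_one_div hα0 hΘ).1 hα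
    have hhalf : 1 / (2 * α) = 1 / α / 2 := by field_simp
    rw [hhalf]
    gcongr
  have hinf : sInf ((fun y => ⟪g x, y - x⟫ + 1 / α / 2 * ‖y - x‖ ^ 2) '' D) =
      ⟪g x, xp - x⟫ + 1 / (2 * α) * ‖xp - x‖ ^ 2 := by
    have hhalf : 1 / α / 2 = 1 / (2 * α) := by field_simp
    rw [hhalf]
    exact IsLeast.csInf_eq ⟨⟨xp, hxp, rfl⟩, Set.forall_mem_image.2 hmin⟩
  have h := hPL x hx
  rw [Dcal, hinf] at h
  have h' := mul_le_mul_of_nonneg_left h hα0.le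
  have hcancel (q : ℝ) : α * (1 / 2 * (-2 * (1 / α) * q)) = -q := by field_simp
  rw [hcancel] at h'
  linarith
end

section
/- Let σ > 0, let (λ_i)_{i∈ℕ} be a sequence of positive reals with λ_i ≥ λ_min for some λ_min > 0, and let (c_i)_{i∈ℕ} be a real sequence with Σ_i |c_i| < ∞. For each integer n ≥ 1, define μ_n := Σ_i (n λ_i / (n λ_i + σ²)) · c_i (the series converges absolutely). Then for every n ≥ 2, |μ_n − μ_{n−1}| ≤ (σ² / (λ_min · n · (n−1))) · Σ_i |c_i|; in particular |μ_n − μ_{n−1}| = O(1/n²). -/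
/-- Consecutive shrinkage coefficients differ by at most `s / (l (t + 1) t)`, for any positive
lower bound `l` on the eigenvalue `x`. -/
theorem abs_shrinkage_sub_le {s x l t : ℝ} (hs : 0 ≤ s) (hl : 0 < l) (hlx : l ≤ x) (ht : 0 < t) :
    |(t + 1) * x / ((t + 1) * x + s) - t * x / (t * x + s)| ≤ s / (l * (t + 1) * t) := by
  have hx : 0 < x := hl.trans_le hlx
  have h1 : 0 < (t + 1) * x + s := by positivity
  have h2 : 0 < t * x + s := by positivity
  have h : (t + 1) * x / ((t + 1) * x + s) - t * x / (t * x + s) =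
      s * x / (((t + 1) * x + s) * (t * x + s)) := by
    rw [div_sub_div _ _ h1.ne' h2.ne']
    ring
  rw [h, abs_of_nonneg (by positivity)]
  calc s * x / (((t + 1) * x + s) * (t * x + s))
      ≤ s * x / (((t + 1) * x) * (t * x)) := by
        gcongr <;> linarith
    _ = s / (x * (t + 1) * t) := by field_simp
    _ ≤ s / (l * (t + 1) * t) := by gcongr

/-- Shrinking the terms of an absolutely summable series preserves summability. -/
theorem summable_shrinkage_mul {s t : ℝ} (hs : 0 ≤ s) (ht : 0 ≤ t) {lam c : ℕ → ℝ}
    (hlam : ∀ i, 0 < lam i) (hc : Summable fun i => |c i|) :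
    Summable fun i => t * lam i / (t * lam i + s) * c i := by
  refine Summable.of_norm_bounded hc fun i => ?_
  have h0 : 0 ≤ t * lam i := mul_nonneg ht (hlam i).le
  rw [Real.norm_eq_abs, abs_mul, abs_of_nonneg (by positivity)]
  exact mul_le_of_le_one_left (abs_nonneg _)
    (div_le_one_of_le₀ (by linarith) (by positivity))

/-- Per-step `O(1/n²)` decay of the posterior-mean difference in the proof of
Lemma 4: if `λ_i ≥ λ_min > 0`, then
`|μ_n - μ_{n-1}| ≤ (σ²/(λ_min n (n-1))) Σ_i |c_i|`. -/
theorem posterior_mean_stepwise_decay (σ : ℝ) (hσ : 0 < σ)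
    (lam : ℕ → ℝ) (hlam : ∀ i, 0 < lam i)
    (lamMin : ℝ) (hlamMin : 0 < lamMin) (hlamLB : ∀ i, lamMin ≤ lam i)
    (c : ℕ → ℝ) (hc : Summable fun i => |c i|)
    (μ : ℕ → ℝ)
    (hμ : ∀ n : ℕ, 1 ≤ n →
      μ n = ∑' i, (n * lam i / (n * lam i + σ ^ 2)) * c i) :
    ∀ n : ℕ, 2 ≤ n →
      |μ n - μ (n - 1)| ≤
        σ ^ 2 / (lamMin * n * ((n : ℝ) - 1)) * ∑' i, |c i| := by
  intro n hn
  obtain ⟨m, rfl⟩ : ∃ m, n = m + 1 := ⟨n - 1, by omega⟩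
  have hm : (0 : ℝ) < m := by exact_mod_cast (by omega : 0 < m)
  rw [Nat.add_sub_cancel, hμ (m + 1) (by omega), hμ m (by omega)]
  push_cast
  rw [add_sub_cancel_right, ← (summable_shrinkage_mul (sq_nonneg σ) (by positivity) hlam
    hc).tsum_sub (summable_shrinkage_mul (sq_nonneg σ) hm.le hlam hc), ← tsum_mul_left,
    ← Real.norm_eq_abs]
  refine tsum_of_norm_bounded (hc.mul_left _).hasSum fun i => ?_
  rw [← sub_mul, Real.norm_eq_abs, abs_mul]
  gcongr
  exact abs_shrinkage_sub_le (sq_nonneg σ) hlamMin (hlamLB i) hm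
end
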